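/- arXiv:1611.08260 — 3 statements merged into one kernel-verified Lean document; each statement's English description precedes it below -/
import Mathlib

section
/- Let M : ℝˢ ⇒ ℝᵈ have closed graph and be metrically subregular at (x̄,ȳ) ∈ gph M. Then T_{M⁻¹(ȳ)}(x̄) = {u : 0 ∈ DM(x̄,ȳ)(u)}. -/
open Filter Topology Metric Set
open scoped RealInnerProductSpace

noncomputable section

abbrev Es (k : ℕ) : Type := EuclideanSpace ℝ (Fin k)

/-- The tangent (contingent) cone to `A` at `x`. -/
def tcone {E : Type*} [NormedAddCommGroup E] [NormedSpace ℝ E] (A : Set E) (x : E) : Set E :=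
  {w | ∃ t : ℕ → ℝ, ∃ w' : ℕ → E,
    (∀ k, 0 < t k) ∧ Tendsto t atTop (𝓝 0) ∧ Tendsto w' atTop (𝓝 w) ∧
    ∀ k, x + t k • w' k ∈ A}

/-- Graph of a multifunction. -/
def gph {E F : Type*} (M : E → Set F) : Set (E × F) := {z | z.2 ∈ M z.1}

/-- The canonical pairing on a product of two real inner product spaces. -/
def pr2 {E F : Type*} [NormedAddCommGroup E] [InnerProductSpace ℝ E]
    [NormedAddCommGroup F] [InnerProductSpace ℝ F] (a b : E × F) : ℝ :=
  ⟪a.1, b.1⟫ + ⟪a.2, b.2⟫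

/-- The regular (Fréchet) normal cone to `A ⊆ E × F` at `z`; it is empty (by convention)
when `z ∉ A`. -/
def rnc2 {E F : Type*} [NormedAddCommGroup E] [InnerProductSpace ℝ E]
    [NormedAddCommGroup F] [InnerProductSpace ℝ F] (A : Set (E × F)) (z : E × F) :
    Set (E × F) :=
  {zs | z ∈ A ∧ ∀ w ∈ tcone A z, pr2 zs w ≤ 0}

/-- The directional limiting normal cone to `A ⊆ E × F` at `z` in direction `w`. -/
def dnc2 {E F : Type*} [NormedAddCommGroup E] [InnerProductSpace ℝ E]
    [NormedAddCommGroup F] [InnerProductSpace ℝ F] (A : Set (E × F)) (z w : E × F) :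
    Set (E × F) :=
  {zs | ∃ t : ℕ → ℝ, ∃ w' : ℕ → E × F, ∃ zs' : ℕ → E × F,
    (∀ k, 0 < t k) ∧ Tendsto t atTop (𝓝 0) ∧ Tendsto w' atTop (𝓝 w) ∧
    Tendsto zs' atTop (𝓝 zs) ∧ ∀ k, zs' k ∈ rnc2 A (z + t k • w' k)}

/-- The multifunction `M : X ⇒ Y` is metrically subregular at `(xb, yb) ∈ gph M`
(with the convention that the distance to the empty set is `+∞`). -/
def MetrSubregAt {X Y : Type*} [MetricSpace X] [MetricSpace Y] (M : X → Set Y) (xb : X)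
    (yb : Y) : Prop :=
  ∃ κ : ℝ, 0 ≤ κ ∧ ∃ ε : ℝ, 0 < ε ∧ ∀ x, dist x xb < ε →
    EMetric.infEdist x {x' | yb ∈ M x'} ≤ ENNReal.ofReal κ * EMetric.infEdist yb (M x)

/-- Points of `M⁻¹(yb)` realise the subregularity estimate up to an arbitrary error `δ > 0`. -/
theorem MetrSubregAt.exists_dist_lt {X Y : Type*} [MetricSpace X] [MetricSpace Y]
    {M : X → Set Y} {xb : X} {yb : Y} (hsub : MetrSubregAt M xb yb) :
    ∃ κ : ℝ, ∃ ε : ℝ, 0 < ε ∧ ∀ x y, dist x xb < ε → y ∈ M x → ∀ δ : ℝ, 0 < δ →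
      ∃ p, yb ∈ M p ∧ dist x p < κ * dist yb y + δ := by
  obtain ⟨κ, hκ, ε, hε, h⟩ := hsub
  refine ⟨κ, ε, hε, fun x y hx hy δ hδ => ?_⟩
  have hnn : 0 ≤ κ * dist yb y := mul_nonneg hκ dist_nonneg
  have hlt : infEDist x {x' | yb ∈ M x'} < ENNReal.ofReal (κ * dist yb y + δ) := by
    calc infEDist x {x' | yb ∈ M x'} ≤ ENNReal.ofReal κ * infEDist yb (M x) := h x hx
      _ ≤ ENNReal.ofReal κ * edist yb y := by gcongr; exact infEDist_le_edist_of_mem hy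
      _ = ENNReal.ofReal (κ * dist yb y) := by rw [edist_dist, ENNReal.ofReal_mul hκ]
      _ < _ := (ENNReal.ofReal_lt_ofReal_iff (by linarith)).2 (by linarith)
  obtain ⟨p, hp, hd⟩ := infEDist_lt_iff.1 hlt
  rw [edist_dist] at hd
  exact ⟨p, hp, (ENNReal.ofReal_lt_ofReal_iff (by linarith)).1 hd⟩

/-- Under metric subregularity, the tangent cone to `M⁻¹(yb)` is described by the
graphical derivative (Corollary `CorTanCone`). -/
theorem stmt16 {s d : ℕ} (M : Es s → Set (Es d)) (xb : Es s) (yb : Es d)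
    (hcl : IsClosed (gph M)) (hbar : yb ∈ M xb)
    (hsub : MetrSubregAt M xb yb) :
    tcone {x | yb ∈ M x} xb = {u | (u, (0 : Es d)) ∈ tcone (gph M) (xb, yb)} := by
  ext u
  constructor
  · rintro ⟨t, w, ht, ht0, hw, hmem⟩
    refine ⟨t, fun k => (w k, 0), ht, ht0, hw.prodMk_nhds tendsto_const_nhds, fun k => ?_⟩
    simpa [gph] using hmem k
  · rintro ⟨t, w, ht, ht0, hw, hmem⟩
    obtain ⟨κ, ε, hε, h⟩ := hsub.exists_dist_lt
    have hw1 : Tendsto (fun k => (w k).1) atTop (𝓝 u) := (continuous_fst.tendsto _).comp hw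
    have hw2 : Tendsto (fun k => (w k).2) atTop (𝓝 0) := (continuous_snd.tendsto _).comp hw
    have hx : Tendsto (fun k => xb + t k • (w k).1) atTop (𝓝 xb) := by
      simpa using tendsto_const_nhds.add (ht0.smul hw1)
    have hp : ∀ k, ∃ p, yb ∈ M p ∧ (dist (xb + t k • (w k).1) xb < ε →
        dist (xb + t k • (w k).1) p < κ * dist yb (yb + t k • (w k).2) + t k * t k) := by
      intro k
      by_cases hk : dist (xb + t k • (w k).1) xb < ε
      · obtain ⟨p, hpM, hpd⟩ := h _ _ hk (hmem k) _ (mul_pos (ht k) (ht k))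
        exact ⟨p, hpM, fun _ => hpd⟩
      · exact ⟨xb, hbar, fun hk' => absurd hk' hk⟩
    choose p hpM hpd using hp
    refine ⟨t, fun k => (t k)⁻¹ • (p k - xb), ht, ht0, ?_, fun k => ?_⟩
    · have hbound : Tendsto (fun k => κ * ‖(w k).2‖ + t k) atTop (𝓝 0) := by
        simpa using (hw2.norm.const_mul κ).add ht0
      refine (tendsto_iff_of_dist (squeeze_zero' (Eventually.of_forall fun _ => dist_nonneg)
        ?_ hbound)).1 hw1
      filter_upwards [hx.eventually (ball_mem_nhds xb hε)] with k hk
      have hd := hpd k hk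
      have hsplit : xb + t k • (w k).1 - p k =
          t k • ((w k).1 - (t k)⁻¹ • (p k - xb)) := by
        rw [smul_sub, smul_inv_smul₀ (ht k).ne']
        abel
      rw [dist_self_add_right, dist_eq_norm, hsplit, norm_smul, norm_smul,
        Real.norm_of_nonneg (ht k).le] at hd
      rw [dist_eq_norm]
      refine le_of_mul_le_mul_left ?_ (ht k)
      linarith
    · simpa [smul_inv_smul₀ (ht k).ne'] using hpM k
end
end

section
/- Let M : ℝˡ × ℝⁿ ⇒ ℝᵐ have closed graph, 0 ∈ M(p̄,x̄), and S(p) := {x : 0 ∈ M(p,x)}. Assume: (a) (q*, 0) ∈ ({(q,u) : 0 ∈ DM(p̄,x̄,0)(q,u)})° implies q* = 0; (b) M is metrically subregular at ((p̄,x̄), 0); and (c) there do not exist (q,u) ≠ (0,0) in ℝˡ × ℝⁿ and (q*, v*) ∈ ℝˡ × ℝᵐ with q* ≠ 0 such that 0 ∈ DM(p̄,x̄,0)(q,u) and (q*, 0) ∈ D*M((p̄,x̄,0); (q,u,0))(v*). Then S has the Aubin property around (p̄, x̄). -/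
open Filter Topology Metric Set
open scoped RealInnerProductSpace

noncomputable section

/-- Graph of a multifunction of two variables, as a subset of a triple product. -/
def gph3 {P X Y : Type*} (M : P × X → Set Y) : Set (P × X × Y) :=
  {z | z.2.2 ∈ M (z.1, z.2.1)}

/-- The canonical pairing on a triple product of real inner product spaces. -/
def pr3 {P X Y : Type*} [NormedAddCommGroup P] [InnerProductSpace ℝ P]
    [NormedAddCommGroup X] [InnerProductSpace ℝ X]
    [NormedAddCommGroup Y] [InnerProductSpace ℝ Y] (a b : P × X × Y) : ℝ :=
  ⟪a.1, b.1⟫ + ⟪a.2.1, b.2.1⟫ + ⟪a.2.2, b.2.2⟫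

/-- The regular (Fréchet) normal cone to `A ⊆ P × X × Y` at `z`; it is empty
(by convention) when `z ∉ A`. -/
def rnc3 {P X Y : Type*} [NormedAddCommGroup P] [InnerProductSpace ℝ P]
    [NormedAddCommGroup X] [InnerProductSpace ℝ X]
    [NormedAddCommGroup Y] [InnerProductSpace ℝ Y]
    (A : Set (P × X × Y)) (z : P × X × Y) : Set (P × X × Y) :=
  {zs | z ∈ A ∧ ∀ w ∈ tcone A z, pr3 zs w ≤ 0}

/-- The directional limiting normal cone to `A ⊆ P × X × Y` at `z` in direction `w`. -/
def dnc3 {P X Y : Type*} [NormedAddCommGroup P] [InnerProductSpace ℝ P]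
    [NormedAddCommGroup X] [InnerProductSpace ℝ X]
    [NormedAddCommGroup Y] [InnerProductSpace ℝ Y]
    (A : Set (P × X × Y)) (z w : P × X × Y) : Set (P × X × Y) :=
  {zs | ∃ t : ℕ → ℝ, ∃ w' : ℕ → P × X × Y, ∃ zs' : ℕ → P × X × Y,
    (∀ k, 0 < t k) ∧ Tendsto t atTop (𝓝 0) ∧ Tendsto w' atTop (𝓝 w) ∧
    Tendsto zs' atTop (𝓝 zs) ∧ ∀ k, zs' k ∈ rnc3 A (z + t k • w' k)}

/-- The polar cone of a subset of a product of two real inner product spaces. -/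
def pol2 {E F : Type*} [NormedAddCommGroup E] [InnerProductSpace ℝ E]
    [NormedAddCommGroup F] [InnerProductSpace ℝ F] (C : Set (E × F)) : Set (E × F) :=
  {zs | ∀ z ∈ C, pr2 zs z ≤ 0}

/-- `F` has the Aubin (Lipschitz-like) property around `(pb, xb) ∈ gph F` (with the
convention that the distance to the empty set is `+∞`). -/
def AubinAround {P X : Type*} [MetricSpace P] [MetricSpace X] (F : P → Set X) (pb : P)
    (xb : X) : Prop :=
  ∃ κ : ℝ, 0 ≤ κ ∧ ∃ ε : ℝ, 0 < ε ∧ ∀ p p' x, dist p pb < ε → dist x xb < ε → x ∈ F p' →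
    EMetric.infEdist x (F p) ≤ ENNReal.ofReal (κ * dist p' p)

/-- `zs` is a proximal normal to `C` at `z`. -/
def IsProxNormal {P X : Type*} [NormedAddCommGroup P] [InnerProductSpace ℝ P]
    [NormedAddCommGroup X] [InnerProductSpace ℝ X] (C : Set (P × X)) (z zs : P × X) : Prop :=
  z ∈ C ∧ ∃ σ : ℝ, 0 ≤ σ ∧ ∃ ρ : ℝ, 0 < ρ ∧ ∀ z' ∈ C, dist z' z < ρ →
    pr2 zs (z' - z) ≤ σ * pr2 (z' - z) (z' - z)

section Penalty

variable {Z Y : Type*} [NormedAddCommGroup Z] [InnerProductSpace ℝ Z] [ProperSpace Z]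
  [NormedAddCommGroup Y] [InnerProductSpace ℝ Y] [ProperSpace Y]

/-- A proximal normal to the zero section `{z | (z, 0) ∈ G}` of a metrically subregular closed
set `G` is approximated by proximal normals to `G` whose second component stays bounded. -/
theorem exists_prox_normal_of_subregular {G : Set (Z × Y)} (hG : IsClosed G) {zh zs : Z}
    (hzh : (zh, (0 : Y)) ∈ G) {κ ρ s η : ℝ} (hκ : 0 ≤ κ) (hρ : 0 < ρ) (hs : 0 ≤ s) (hη : 0 < η)
    (hsub : ∀ z y, (z, y) ∈ G → dist z zh < ρ → ∃ z', (z', (0 : Y)) ∈ G ∧ ‖z' - z‖ ≤ κ * ‖y‖)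
    (hprox : ∀ z, (z, (0 : Y)) ∈ G → dist z zh < ρ → ⟪zs, z - zh⟫ ≤ s * ‖z - zh‖ ^ 2) :
    ∃ (z zs' : Z) (y v : Y), (z, y) ∈ G ∧ ‖z - zh‖ ≤ η ∧ ‖y‖ ≤ η ∧ ‖zs' - zs‖ ≤ η ∧
      ‖v‖ ≤ 2 * (κ * (‖zs‖ + 1)) ∧ ∃ τ : ℝ, ∃ r : ℝ, 0 < r ∧
        ∀ z' y', (z', y') ∈ G → dist z' z < r → dist y' y < r →
          ⟪zs', z' - z⟫ + ⟪v, y' - y⟫ ≤ τ * (‖z' - z‖ ^ 2 + ‖y' - y‖ ^ 2) := by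
  set S := s + 1 with hS
  have hS0 : 0 < S := by positivity
  set K := κ * (‖zs‖ + 1) with hK
  have hK0 : 0 ≤ K := by positivity
  obtain ⟨ρ1, hρ1, hρ1ρ, hSρ⟩ : ∃ ρ1 : ℝ, 0 < ρ1 ∧ 2 * ρ1 < ρ ∧ S * (3 * ρ1) ≤ 1 := by
    refine ⟨min (ρ / 4) (1 / (3 * S)), by positivity, ?_, ?_⟩
    · have := min_le_left (ρ / 4) (1 / (3 * S)); linarith
    · have := min_le_right (ρ / 4) (1 / (3 * S))
      calc S * (3 * min (ρ / 4) (1 / (3 * S))) ≤ S * (3 * (1 / (3 * S))) := by gcongr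
        _ = 1 := by field_simp
  obtain ⟨η', hη', hη'η, hSη, hη'ρ⟩ : ∃ η' : ℝ, 0 < η' ∧ η' ≤ η ∧ 2 * S * η' ≤ η ∧
      η' ≤ ρ1 / 2 := by
    refine ⟨min η (min (η / (2 * S)) (ρ1 / 2)), by positivity, min_le_left _ _, ?_,
      (min_le_right _ _).trans (min_le_right _ _)⟩
    calc 2 * S * min η (min (η / (2 * S)) (ρ1 / 2)) ≤ 2 * S * (η / (2 * S)) := by
          gcongr
          exact (min_le_right _ _).trans (min_le_left _ _)
      _ = η := by field_simp
  obtain ⟨ω, hω, hωη, hκω, hKω⟩ : ∃ ω : ℝ, 0 < ω ∧ ω ≤ η' ∧ κ * ω ≤ η' / 2 ∧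
      K * ω ≤ (η' / 2) ^ 2 := by
    refine ⟨min η' (min (η' / 2 / (κ + 1)) ((η' / 2) ^ 2 / (K + 1))), by positivity,
      min_le_left _ _, ?_, ?_⟩
    · calc κ * min η' (min (η' / 2 / (κ + 1)) ((η' / 2) ^ 2 / (K + 1)))
          ≤ (κ + 1) * (η' / 2 / (κ + 1)) := by
            gcongr
            · linarith
            · exact (min_le_right _ _).trans (min_le_left _ _)
        _ = η' / 2 := by field_simp
    · calc K * min η' (min (η' / 2 / (κ + 1)) ((η' / 2) ^ 2 / (K + 1)))
          ≤ (K + 1) * ((η' / 2) ^ 2 / (K + 1)) := by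
            gcongr
            · linarith
            · exact (min_le_right _ _).trans (min_le_right _ _)
        _ = (η' / 2) ^ 2 := by field_simp
  set r := ‖zs‖ * ρ1 / ω ^ 2 + 1 with hr
  have hr0 : 0 < r := by positivity
  have hrω : ‖zs‖ * ρ1 ≤ r * ω ^ 2 := by
    have : r * ω ^ 2 = ‖zs‖ * ρ1 + ω ^ 2 := by rw [hr]; field_simp
    rw [this]; nlinarith [sq_nonneg ω]
  set h : Z × Y → ℝ := fun w => - ⟪zs, w.1 - zh⟫ + S * ‖w.1 - zh‖ ^ 2 + r * ‖w.2‖ ^ 2 with hh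
  have hcont : Continuous h := by fun_prop
  have hcomp : IsCompact (G ∩ closedBall (zh, (0 : Y)) ρ1) :=
    (isCompact_closedBall _ _).inter_left hG
  obtain ⟨⟨z, y⟩, ⟨hzG, hzB⟩, hmin⟩ := hcomp.exists_isMinOn
    ⟨(zh, 0), hzh, mem_closedBall_self hρ1.le⟩ hcont.continuousOn
  rw [isMinOn_iff] at hmin
  rw [mem_closedBall, Prod.dist_eq, max_le_iff] at hzB
  obtain ⟨hzB1, hzB2⟩ := hzB
  simp only [dist_eq_norm, sub_zero] at hzB1 hzB2
  have h0 : h (z, y) ≤ 0 := by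
    have := hmin (zh, 0) ⟨hzh, mem_closedBall_self hρ1.le⟩
    simpa [hh] using this
  simp only [hh] at h0
  have hcs : ⟪zs, z - zh⟫ ≤ ‖zs‖ * ‖z - zh‖ := real_inner_le_norm _ _
  have hyω : ‖y‖ ≤ ω := by
    have h1 : ‖zs‖ * ‖z - zh‖ ≤ ‖zs‖ * ρ1 := by gcongr
    have h2 : 0 ≤ S * ‖z - zh‖ ^ 2 := by positivity
    have h3 : r * ‖y‖ ^ 2 ≤ r * ω ^ 2 := by linarith
    exact le_of_sq_le_sq (le_of_mul_le_mul_left h3 hr0) hω.le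
  obtain ⟨z', hz'G, hz'⟩ := hsub z y hzG (by rw [dist_eq_norm]; linarith)
  have hκy : κ * ‖y‖ ≤ η' / 2 := (by gcongr : κ * ‖y‖ ≤ κ * ω).trans hκω
  have hz'h : ‖z' - zh‖ ≤ 2 * ρ1 := by
    calc ‖z' - zh‖ ≤ ‖z' - z‖ + ‖z - zh‖ := norm_sub_le_norm_sub_add_norm_sub _ _ _
      _ ≤ 2 * ρ1 := by linarith
  have hp := hprox z' hz'G (by rw [dist_eq_norm]; linarith)
  have key : ‖z' - zh‖ ^ 2 + r * ‖y‖ ^ 2 ≤ K * ‖y‖ := by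
    have e1 : ⟪zs, z - zh⟫ - ⟪zs, z' - zh⟫ ≤ ‖zs‖ * (κ * ‖y‖) := by
      rw [← inner_sub_right]
      have : z - zh - (z' - zh) = z - z' := by abel
      rw [this]
      refine (real_inner_le_norm _ _).trans ?_
      rw [norm_sub_rev]
      gcongr
    have e2 : S * (‖z' - zh‖ ^ 2 - ‖z - zh‖ ^ 2) ≤ κ * ‖y‖ := by
      have : ‖z' - zh‖ - ‖z - zh‖ ≤ κ * ‖y‖ := by
        have := norm_sub_le_norm_sub_add_norm_sub z' z zh
        linarith
      have e3 : S * (‖z' - zh‖ + ‖z - zh‖) ≤ 1 :=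
        (by gcongr; linarith : S * (‖z' - zh‖ + ‖z - zh‖) ≤ S * (3 * ρ1)).trans hSρ
      calc S * (‖z' - zh‖ ^ 2 - ‖z - zh‖ ^ 2)
          = (S * (‖z' - zh‖ + ‖z - zh‖)) * (‖z' - zh‖ - ‖z - zh‖) := by ring
        _ ≤ (S * (‖z' - zh‖ + ‖z - zh‖)) * (κ * ‖y‖) := by gcongr
        _ ≤ 1 * (κ * ‖y‖) := by gcongr
        _ = κ * ‖y‖ := one_mul _
    have e4 : S * ‖z' - zh‖ ^ 2 = s * ‖z' - zh‖ ^ 2 + ‖z' - zh‖ ^ 2 := by rw [hS]; ring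
    have e5 : K * ‖y‖ = ‖zs‖ * (κ * ‖y‖) + κ * ‖y‖ := by rw [hK]; ring
    linarith
  have hKy : K * ‖y‖ ≤ (η' / 2) ^ 2 := (by gcongr : K * ‖y‖ ≤ K * ω).trans hKω
  have hz'η : ‖z' - zh‖ ≤ η' / 2 := by
    refine le_of_sq_le_sq ?_ (by positivity)
    have : 0 ≤ r * ‖y‖ ^ 2 := by positivity
    linarith
  have hzη : ‖z - zh‖ ≤ η' := by
    have := norm_sub_le_norm_sub_add_norm_sub z z' zh
    rw [norm_sub_rev z z'] at this
    linarith
  refine ⟨z, zs - (2 * S) • (z - zh), y, -(2 * r) • y, hzG, hzη.trans hη'η,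
    (hyω.trans hωη).trans hη'η, ?_, ?_, S + r, ρ1 / 2, by positivity, ?_⟩
  · rw [sub_sub_cancel_left, norm_neg, norm_smul, Real.norm_of_nonneg (by positivity)]
    exact (by gcongr : 2 * S * ‖z - zh‖ ≤ 2 * S * η').trans hSη
  · rw [norm_smul, norm_neg, Real.norm_of_nonneg (by positivity), mul_assoc]
    gcongr
    rcases (norm_nonneg y).eq_or_lt with h | h
    · rw [← h]; simpa using hK0
    · have : (r * ‖y‖) * ‖y‖ ≤ K * ‖y‖ := by nlinarith [sq_nonneg ‖z' - zh‖]
      exact le_of_mul_le_mul_right this h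
  · intro z1 y1 h1 hd1 hd2
    rw [dist_eq_norm] at hd1 hd2
    have hm := hmin (z1, y1) ⟨h1, by
      rw [mem_closedBall, Prod.dist_eq, max_le_iff]
      simp only [dist_eq_norm, sub_zero]
      constructor
      · have := norm_sub_le_norm_sub_add_norm_sub z1 z zh
        linarith
      · have := norm_sub_le_norm_sub_add_norm_sub y1 y 0
        simp only [sub_zero] at this
        linarith⟩
    simp only [hh] at hm
    have e1 : z1 - zh = (z1 - z) + (z - zh) := by abel
    have e2 : ‖y1‖ ^ 2 = ‖y1 - y‖ ^ 2 + 2 * ⟪y1 - y, y⟫ + ‖y‖ ^ 2 := by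
      rw [← norm_add_sq_real, sub_add_cancel]
    rw [e1, inner_add_right, norm_add_sq_real, e2] at hm
    rw [inner_sub_left, real_inner_smul_left, real_inner_smul_left,
      real_inner_comm (z1 - z) (z - zh), real_inner_comm (y1 - y) y]
    have p1 : 0 ≤ r * ‖z1 - z‖ ^ 2 := by positivity
    have p2 : 0 ≤ S * ‖y1 - y‖ ^ 2 := by positivity
    nlinarith

end Penalty

/-- A function that is linear along rays and dominated near `z` by a quadratic one on `A` is
nonpositive on the tangent cone. -/
theorem nonpos_of_mem_tcone {E : Type*} [NormedAddCommGroup E] [NormedSpace ℝ E] {A : Set E}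
    {z : E} {φ Q : E → ℝ} (hφ : Continuous φ) (hQ : Continuous Q)
    (hφs : ∀ (t : ℝ) w, φ (t • w) = t * φ w) (hQs : ∀ (t : ℝ) w, Q (t • w) = t ^ 2 * Q w)
    {ρ : ℝ} (hρ : 0 < ρ) (h : ∀ z' ∈ A, dist z' z < ρ → φ (z' - z) ≤ Q (z' - z))
    {w : E} (hw : w ∈ tcone A z) : φ w ≤ 0 := by
  obtain ⟨t, w', ht, ht0, hw', hA⟩ := hw
  have h1 : Tendsto (fun k => t k • w' k) atTop (𝓝 0) := by simpa using ht0.smul hw'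
  have h2 : ∀ᶠ k in atTop, φ (w' k) ≤ t k * Q (w' k) := by
    filter_upwards [h1.norm.eventually (gt_mem_nhds (by simpa using hρ))] with k hk
    have := h _ (hA k) (by simpa [dist_eq_norm] using hk)
    rw [add_sub_cancel_left, hφs, hQs, pow_two, mul_assoc] at this
    exact le_of_mul_le_mul_left this (ht k)
  have h3 : Tendsto (fun k => t k * Q (w' k)) atTop (𝓝 0) := by
    simpa using ht0.mul ((hQ.tendsto w).comp hw')
  exact le_of_tendsto_of_tendsto ((hφ.tendsto w).comp hw') h3 h2

section Cones

variable {P X Y : Type*} [NormedAddCommGroup P] [InnerProductSpace ℝ P]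
  [NormedAddCommGroup X] [InnerProductSpace ℝ X] [NormedAddCommGroup Y] [InnerProductSpace ℝ Y]

theorem IsProxNormal.pr2_nonpos {C : Set (P × X)} {z zs : P × X} (h : IsProxNormal C z zs)
    {w : P × X} (hw : w ∈ tcone C z) : pr2 zs w ≤ 0 := by
  obtain ⟨-, σ, -, ρ, hρ, h⟩ := h
  refine nonpos_of_mem_tcone (φ := fun w => pr2 zs w) (Q := fun w => σ * pr2 w w) ?_ ?_ ?_ ?_ hρ
    h hw
  · unfold pr2; fun_prop
  · unfold pr2; fun_prop
  · intro t w
    simp only [pr2, Prod.smul_fst, Prod.smul_snd, real_inner_smul_right]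
    ring
  · intro t w
    simp only [pr2, Prod.smul_fst, Prod.smul_snd, real_inner_smul_right, real_inner_smul_left]
    ring

theorem mem_rnc3_of_prox {A : Set (P × X × Y)} {z zs : P × X × Y} (hz : z ∈ A) {τ ρ : ℝ}
    (hρ : 0 < ρ)
    (h : ∀ z' ∈ A, dist z' z < ρ → pr3 zs (z' - z) ≤ τ * pr3 (z' - z) (z' - z)) :
    zs ∈ rnc3 A z := by
  refine ⟨hz, fun w hw => ?_⟩
  refine nonpos_of_mem_tcone (φ := fun w => pr3 zs w) (Q := fun w => τ * pr3 w w) ?_ ?_ ?_ ?_ hρ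
    h hw
  · unfold pr3; fun_prop
  · unfold pr3; fun_prop
  · intro t w
    simp only [pr3, Prod.smul_fst, Prod.smul_snd, real_inner_smul_right]
    ring
  · intro t w
    simp only [pr3, Prod.smul_fst, Prod.smul_snd, real_inner_smul_right, real_inner_smul_left]
    ring

/-- Under metric subregularity, a direction whose image under the graphical derivative contains
`0` is tangent to the solution set. -/
theorem mem_tcone_zeros {M : P × X → Set Y} {zb : P × X} {κ ε : ℝ} (hε : 0 < ε)
    (hsub : ∀ z y, y ∈ M z → dist z zb < ε → ∃ z', (0 : Y) ∈ M z' ∧ dist z' z ≤ κ * ‖y‖)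
    {q : P} {u : X} (h : (q, u, (0 : Y)) ∈ tcone (gph3 M) (zb.1, zb.2, (0 : Y))) :
    (q, u) ∈ tcone {z | (0 : Y) ∈ M z} zb := by
  obtain ⟨t, w', ht, ht0, hw', hA⟩ := h
  have hq : Tendsto (fun k => (w' k).1) atTop (𝓝 q) := (continuous_fst.tendsto _).comp hw'
  have hu : Tendsto (fun k => (w' k).2.1) atTop (𝓝 u) :=
    (continuous_snd.fst.tendsto _).comp hw'
  have hv : Tendsto (fun k => (w' k).2.2) atTop (𝓝 0) :=
    (continuous_snd.snd.tendsto _).comp hw'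
  have hqu : Tendsto (fun k => ((w' k).1, (w' k).2.1)) atTop (𝓝 (q, u)) := hq.prodMk_nhds hu
  have h0 : Tendsto (fun k => t k • ((w' k).1, (w' k).2.1)) atTop (𝓝 0) := by
    simpa using ht0.smul hqu
  have hev : ∀ᶠ k in atTop, ∃ z', (0 : Y) ∈ M z' ∧
      dist z' (zb + t k • ((w' k).1, (w' k).2.1)) ≤ κ * ‖t k • (w' k).2.2‖ := by
    filter_upwards [h0.norm.eventually (gt_mem_nhds (by simpa using hε))] with k hk
    have hAk : (0 : Y) + t k • (w' k).2.2 ∈ M (zb + t k • ((w' k).1, (w' k).2.1)) := hA k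
    rw [zero_add] at hAk
    exact hsub _ _ hAk (by simpa [dist_eq_norm] using hk)
  obtain ⟨N, hN⟩ := eventually_atTop.1 hev
  choose z' hz' hd using fun k => hN (k + N) (Nat.le_add_left _ _)
  refine ⟨fun k => t (k + N), fun k => (t (k + N))⁻¹ • (z' k - zb), fun k => ht _,
    ht0.comp (tendsto_add_atTop_nat N), ?_, fun k => ?_⟩
  · have hb : ∀ k, dist ((w' (k + N)).1, (w' (k + N)).2.1) ((t (k + N))⁻¹ • (z' k - zb)) ≤
        κ * ‖(w' (k + N)).2.2‖ := by
      intro k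
      have hk := hd k
      rw [norm_smul, Real.norm_of_nonneg (ht _).le] at hk
      have : ((w' (k + N)).1, (w' (k + N)).2.1) - (t (k + N))⁻¹ • (z' k - zb) =
          -((t (k + N))⁻¹ • (z' k - (zb + t (k + N) • ((w' (k + N)).1, (w' (k + N)).2.1)))) := by
        rw [← sub_sub, smul_sub _ (z' k - zb), inv_smul_smul₀ (ht _).ne']
        abel
      rw [dist_eq_norm, this, norm_neg, norm_smul, norm_inv, Real.norm_of_nonneg (ht _).le,
        ← dist_eq_norm, inv_mul_le_iff₀ (ht _)]
      linarith
    have hlim : Tendsto (fun k => κ * ‖(w' (k + N)).2.2‖) atTop (𝓝 0) := by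
      simpa using (hv.comp (tendsto_add_atTop_nat N)).norm.const_mul κ
    refine (hqu.comp (tendsto_add_atTop_nat N)).congr_dist ?_
    exact squeeze_zero (fun _ => dist_nonneg) hb hlim
  · show (0 : Y) ∈ M _
    rw [smul_inv_smul₀ (ht _).ne', add_sub_cancel]
    exact hz' k

end Cones

/-- Metric subregularity with the projection onto the solution set attained. -/
theorem exists_zero_of_subregular {P X Y : Type*} [NormedAddCommGroup P] [ProperSpace P]
    [NormedAddCommGroup X] [ProperSpace X] [NormedAddCommGroup Y] {M : P × X → Set Y}
    {zb : P × X} (hcl : IsClosed {z | (0 : Y) ∈ M z}) (hbar : (0 : Y) ∈ M zb) {κ : ℝ}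
    (hκ : 0 ≤ κ) {z : P × X}
    (h : Metric.infEDist z {z' | (0 : Y) ∈ M z'} ≤
      ENNReal.ofReal κ * Metric.infEDist (0 : Y) (M z)) {y : Y} (hy : y ∈ M z) :
    ∃ z', (0 : Y) ∈ M z' ∧ dist z' z ≤ κ * ‖y‖ := by
  obtain ⟨z', hz', hd⟩ := hcl.exists_infDist_eq_dist ⟨zb, hbar⟩ z
  refine ⟨z', hz', ?_⟩
  rw [dist_comm, ← hd, Metric.infDist]
  refine ENNReal.toReal_le_of_le_ofReal (by positivity) (h.trans ?_)
  rw [ENNReal.ofReal_mul hκ]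
  gcongr
  refine (Metric.infEDist_le_edist_of_mem hy).trans ?_
  rw [edist_dist, dist_zero_left]

theorem WithLp.norm_le_norm_fst_add_norm_snd {P X : Type*} [NormedAddCommGroup P]
    [NormedAddCommGroup X] (z : WithLp 2 (P × X)) :
    ‖z‖ ≤ ‖z.fst‖ + ‖z.snd‖ := by
  refine le_of_sq_le_sq ?_ (by positivity)
  rw [WithLp.prod_norm_sq_eq_of_L2]
  nlinarith [norm_nonneg z.fst, norm_nonneg z.snd]

section Approx

variable {P X Y : Type*} [NormedAddCommGroup P] [InnerProductSpace ℝ P] [FiniteDimensional ℝ P]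
  [NormedAddCommGroup X] [InnerProductSpace ℝ X] [FiniteDimensional ℝ X]
  [NormedAddCommGroup Y] [InnerProductSpace ℝ Y] [FiniteDimensional ℝ Y]

/-- Proximal normals to the solution set are approximated by regular normals to the graph with
bounded last component. -/
theorem exists_mem_rnc3_of_isProxNormal {M : P × X → Set Y} (hcl : IsClosed (gph3 M))
    {zb : P × X} {κ ε : ℝ} (hκ : 0 ≤ κ)
    (hsub : ∀ z y, y ∈ M z → dist z zb < ε → ∃ z', (0 : Y) ∈ M z' ∧ dist z' z ≤ κ * ‖y‖)
    {zh zs : P × X} (hz : dist zh zb < ε) (hn : IsProxNormal {z | (0 : Y) ∈ M z} zh zs)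
    {η : ℝ} (hη : 0 < η) :
    ∃ z ns : P × X × Y, ns ∈ rnc3 (gph3 M) z ∧ dist z (zh.1, zh.2, 0) ≤ η ∧
      dist ns.1 zs.1 ≤ η ∧ dist ns.2.1 zs.2 ≤ η ∧
      ‖ns.2.2‖ ≤ 2 * (2 * κ * (‖zs.1‖ + ‖zs.2‖ + 1)) := by
  obtain ⟨hzh, σ, hσ, ρ, hρ, hp⟩ := hn
  set G : Set (WithLp 2 (P × X) × Y) := {w | (w.1.fst, w.1.snd, w.2) ∈ gph3 M} with hGdef
  have hG : IsClosed G := hcl.preimage (by fun_prop)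
  have hle : ∀ z z' : WithLp 2 (P × X), dist z.ofLp z'.ofLp ≤ dist z z' := fun z z' => by
    rw [Prod.dist_eq, dist_eq_norm z z']
    exact max_le (by simpa [dist_eq_norm] using WithLp.norm_fst_le P (z - z'))
      (by simpa [dist_eq_norm] using WithLp.norm_snd_le P (z - z'))
  obtain ⟨z, zs', y, v, hzG, h1, h2, h3, h4, τ, r, hr, h5⟩ :=
    exists_prox_normal_of_subregular (Y := Y) (zh := WithLp.toLp 2 zh) (zs := WithLp.toLp 2 zs)
      hG (by simpa [hGdef, gph3] using hzh) (κ := 2 * κ) (ρ := min ρ (ε - dist zh zb))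
      (by positivity) (lt_min hρ (by linarith)) hσ hη
      (fun z y hzy hd => by
        obtain ⟨z', hz', hd'⟩ := hsub z.ofLp y hzy (by
          have := dist_triangle z.ofLp zh zb
          have := hle z (WithLp.toLp 2 zh)
          have := hd.trans_le (min_le_right _ _)
          linarith)
        refine ⟨WithLp.toLp 2 z', hz', (WithLp.norm_le_norm_fst_add_norm_snd _).trans ?_⟩
        rw [Prod.dist_eq, max_le_iff, dist_eq_norm, dist_eq_norm] at hd'
        have e1 : (WithLp.toLp 2 z' - z).fst = z'.1 - z.fst := rfl
        have e2 : (WithLp.toLp 2 z' - z).snd = z'.2 - z.snd := rfl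
        rw [e1, e2]
        have := hd'.1
        have := hd'.2
        simp only [WithLp.ofLp_fst, WithLp.ofLp_snd] at *
        linarith)
      (fun z hz0 hd => by
        have := hp z.ofLp hz0 ((hle z (WithLp.toLp 2 zh)).trans_lt
          (hd.trans_le (min_le_left _ _)))
        rw [← real_inner_self_eq_norm_sq, WithLp.prod_inner_apply, WithLp.prod_inner_apply]
        exact this)
  refine ⟨(z.fst, z.snd, y), (zs'.fst, zs'.snd, v), ?_, ?_, ?_, ?_, ?_⟩
  · refine mem_rnc3_of_prox hzG (τ := τ) (ρ := r / 2) (by positivity) ?_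
    rintro ⟨p', x', y'⟩ hz' hd
    rw [Prod.dist_eq, Prod.dist_eq, max_lt_iff, max_lt_iff] at hd
    simp only [dist_eq_norm] at hd
    have := h5 (WithLp.toLp 2 (p', x')) y' hz' (by
      rw [dist_eq_norm]
      refine (WithLp.norm_le_norm_fst_add_norm_snd _).trans_lt ?_
      have e1 : (WithLp.toLp 2 (p', x') - z).fst = p' - z.fst := rfl
      have e2 : (WithLp.toLp 2 (p', x') - z).snd = x' - z.snd := rfl
      rw [e1, e2]
      linarith [hd.1, hd.2.1]) (by rw [dist_eq_norm]; linarith [hd.2.2])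
    rw [← real_inner_self_eq_norm_sq, ← real_inner_self_eq_norm_sq, WithLp.prod_inner_apply,
      WithLp.prod_inner_apply] at this
    exact this
  · rw [Prod.dist_eq, Prod.dist_eq]
    have hz1 := (hle z (WithLp.toLp 2 zh)).trans (dist_eq_norm _ _).le
    rw [Prod.dist_eq, max_le_iff] at hz1
    exact max_le (hz1.1.trans h1) (max_le (hz1.2.trans h1) (by simpa using h2))
  · rw [dist_eq_norm]
    exact (WithLp.norm_fst_le P (zs' - WithLp.toLp 2 zs)).trans h3
  · rw [dist_eq_norm]
    exact (WithLp.norm_snd_le P (zs' - WithLp.toLp 2 zs)).trans h3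
  · refine h4.trans ?_
    gcongr
    exact WithLp.norm_le_norm_fst_add_norm_snd (WithLp.toLp 2 zs)

end Approx

/-- It suffices to verify the Aubin property for parameters close to the reference point. -/
theorem aubinAround_of_local {P X : Type*} [MetricSpace P] [MetricSpace X]
    {F : P → Set X} {pb : P} {xb : X} (hb : xb ∈ F pb) {κ ε : ℝ}
    (hκ : 0 ≤ κ) (hε : 0 < ε)
    (h : ∀ p p' x, dist p pb < ε → dist p' pb < ε → dist x xb < ε → x ∈ F p' →
      Metric.infEDist x (F p) ≤ ENNReal.ofReal (κ * dist p' p)) : AubinAround F pb xb := by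
  refine ⟨κ + 1, by positivity, ε / 2, by positivity, fun p p' x hp hx hxF => ?_⟩
  rcases lt_or_ge (dist p' pb) ε with hp' | hp'
  · refine (h p p' x (by linarith) hp' (by linarith) hxF).trans (ENNReal.ofReal_le_ofReal ?_)
    have : 0 ≤ dist p' p := dist_nonneg
    linarith
  · have h1 := h p pb xb (by linarith) (by simpa using hε) (by simpa using hε) hb
    have h2 : Metric.infEDist x (F p) ≤ Metric.infEDist xb (F p) + edist x xb :=
      Metric.infEDist_le_infEDist_add_edist
    refine (h2.trans (add_le_add_left h1 _)).trans ?_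
    rw [edist_dist, ← ENNReal.ofReal_add (by positivity) dist_nonneg]
    refine ENNReal.ofReal_le_ofReal ?_
    have h3 := dist_triangle p' p pb
    have h4 : dist pb p < ε / 2 := by rwa [dist_comm]
    have h5 : κ * dist pb p ≤ κ * dist p' p := by gcongr; linarith
    linarith

section Aubin

variable {P X : Type*} [NormedAddCommGroup P] [InnerProductSpace ℝ P] [ProperSpace P]
  [NormedAddCommGroup X] [InnerProductSpace ℝ X] [ProperSpace X]

/-- If no proximal normal to the closed graph `C` near the reference point is almost horizontal,
then the associated multifunction has the Aubin property. -/
theorem aubinAround_of_isProxNormal {C : Set (P × X)} (hC : IsClosed C) {pb : P} {xb : X}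
    (hb : (pb, xb) ∈ C) {ε τ : ℝ} (hε : 0 < ε) (hτ : 0 < τ)
    (h : ∀ z a b, dist z (pb, xb) < ε → IsProxNormal C z (a, b) → ‖a‖ = 1 → ‖b‖ < τ → False) :
    AubinAround (fun p => {x | (p, x) ∈ C}) pb xb := by
  obtain ⟨k, hk, hkτ⟩ : ∃ k : ℝ, 0 < k ∧ 2 / k < τ :=
    ⟨2 / τ + 1, by positivity, by rw [div_lt_iff₀ (by positivity)]; field_simp; linarith⟩
  have hε1 : 0 < ε / (2 * k + 4) := by positivity
  refine aubinAround_of_local hb hk.le hε1 fun p p' x hp hp' hx hxF => ?_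
  by_contra! hlt
  have hpp : p' ≠ p := by
    rintro rfl
    rw [Metric.infEDist_zero_of_mem hxF] at hlt
    exact not_lt_zero hlt
  set δ := dist p' p with hδ
  have hδ0 : 0 < δ := dist_pos.2 hpp
  have hfar : ∀ x', (p, x') ∈ C → k * δ < ‖x' - x‖ := by
    intro x' hx'
    have h1 := hlt.trans_le (Metric.infEDist_le_edist_of_mem (s := {x | (p, x) ∈ C}) hx')
    rw [edist_dist, dist_comm, dist_eq_norm] at h1
    exact (ENNReal.ofReal_lt_ofReal_iff_of_nonneg (by positivity)).1 h1
  set e := ε / (2 * k + 4) with he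
  have hek : (2 * k + 4) * e = ε := by rw [he]; field_simp
  have hδe : δ < 2 * e := by
    have := dist_triangle_right p' p pb
    linarith
  set α := 1 / (k ^ 2 * δ) with hα
  have hα0 : 0 < α := by positivity
  set f : P × X → ℝ := fun z => ‖z.1 - p‖ + α * ‖z.2 - x‖ ^ 2 with hf
  have hfc : Continuous f := by fun_prop
  set R := (2 * k + 3) * e with hR
  have hR0 : 0 < R := by positivity
  have hmem : (p', x) ∈ closedBall (pb, xb) R := by
    rw [mem_closedBall, Prod.dist_eq]
    have : e ≤ R := by rw [hR]; nlinarith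
    exact max_le (by simpa using hp'.le.trans this) (by simpa using hx.le.trans this)
  obtain ⟨⟨ph, xh⟩, ⟨hzC, hzB⟩, hmin⟩ :=
    ((isCompact_closedBall (pb, xb) R).inter_left hC).exists_isMinOn
      ⟨(p', x), hxF, hmem⟩ hfc.continuousOn
  rw [isMinOn_iff] at hmin
  have h0 : ‖ph - p‖ + α * ‖xh - x‖ ^ 2 ≤ δ := by
    have := hmin (p', x) ⟨hxF, hmem⟩
    simpa [hf, hδ, dist_eq_norm] using this
  have hph : ‖ph - p‖ ≤ δ := by
    have : 0 ≤ α * ‖xh - x‖ ^ 2 := by positivity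
    linarith
  have hxh : ‖xh - x‖ ≤ k * δ := by
    refine le_of_sq_le_sq ?_ (by positivity)
    have h1 : α * ‖xh - x‖ ^ 2 ≤ δ := by linarith [norm_nonneg (ph - p)]
    rw [hα, one_div, inv_mul_le_iff₀ (by positivity)] at h1
    linarith
  have hne : 0 < ‖ph - p‖ := by
    rw [norm_pos_iff, sub_ne_zero]
    rintro rfl
    exact absurd (hfar xh hzC) (not_lt.2 hxh)
  set c := ‖ph - p‖ with hc
  have hdist : dist (ph, xh) (pb, xb) < R := by
    rw [Prod.dist_eq]
    refine max_lt ?_ ?_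
    · have := dist_triangle ph p pb
      rw [dist_eq_norm ph p] at this
      simp only
      nlinarith
    · have := dist_triangle xh x xb
      rw [dist_eq_norm xh x] at this
      simp only
      nlinarith
  refine h (ph, xh) (-(c⁻¹ • (ph - p))) (-((2 * α) • (xh - x))) (by rw [hR] at hdist; linarith)
    ⟨hzC, c⁻¹ / 2 + α, by positivity, R - dist (ph, xh) (pb, xb), by linarith, ?_⟩ ?_ ?_
  · rintro ⟨p1, x1⟩ h1C h1d
    have hm := hmin (p1, x1) ⟨h1C, by
      rw [mem_closedBall]
      have := dist_triangle (p1, x1) (ph, xh) (pb, xb)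
      linarith⟩
    simp only [hf] at hm
    rw [← hc] at hm
    have e1 : ‖p1 - p‖ ^ 2 = ‖p1 - ph‖ ^ 2 + 2 * ⟪p1 - ph, ph - p⟫ + c ^ 2 := by
      rw [hc, ← norm_add_sq_real, sub_add_sub_cancel]
    have e2 : ‖x1 - x‖ ^ 2 = ‖x1 - xh‖ ^ 2 + 2 * ⟪x1 - xh, xh - x⟫ + ‖xh - x‖ ^ 2 := by
      rw [← norm_add_sq_real, sub_add_sub_cancel]
    have e3 : ‖p1 - p‖ - c ≤ c⁻¹ / 2 * ‖p1 - ph‖ ^ 2 + c⁻¹ * ⟪p1 - ph, ph - p⟫ := by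
      have : c⁻¹ / 2 * ‖p1 - ph‖ ^ 2 + c⁻¹ * ⟪p1 - ph, ph - p⟫ =
          c⁻¹ / 2 * (‖p1 - p‖ ^ 2 - c ^ 2) := by rw [e1]; ring
      rw [this, ← sub_nonneg]
      have : c⁻¹ / 2 * (‖p1 - p‖ ^ 2 - c ^ 2) - (‖p1 - p‖ - c) =
          c⁻¹ / 2 * (‖p1 - p‖ - c) ^ 2 := by field_simp; ring
      rw [this]
      positivity
    rw [e2] at hm
    simp only [pr2, Prod.fst_sub, Prod.snd_sub, inner_neg_left, real_inner_smul_left,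
      real_inner_self_eq_norm_sq]
    rw [real_inner_comm (p1 - ph), real_inner_comm (x1 - xh)]
    have p1' : 0 ≤ α * ‖p1 - ph‖ ^ 2 := by positivity
    have p2' : 0 ≤ c⁻¹ / 2 * ‖x1 - xh‖ ^ 2 := by positivity
    linarith
  · rw [norm_neg, norm_smul, norm_inv, ← hc, Real.norm_of_nonneg hne.le, inv_mul_cancel₀ hne.ne']
  · rw [norm_neg, norm_smul, Real.norm_of_nonneg (by positivity)]
    calc 2 * α * ‖xh - x‖ ≤ 2 * α * (k * δ) := by gcongr
      _ = 2 / k := by rw [hα]; field_simp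
      _ < τ := hkτ

end Aubin

/-- If `(a, 0)` is polar to `T` only for `a = 0`, then no `(a, b)` with `a` a unit vector and `b`
small is polar to `T`. -/
theorem exists_pos_of_pol2 {P X : Type*} [NormedAddCommGroup P] [InnerProductSpace ℝ P]
    [ProperSpace P] [NormedAddCommGroup X] [InnerProductSpace ℝ X] {T : Set (P × X)}
    (ha : ∀ a : P, (a, (0 : X)) ∈ pol2 T → a = 0) :
    ∃ τ : ℝ, 0 < τ ∧ ∀ (a : P) (b : X), (a, b) ∈ pol2 T → ‖a‖ = 1 → ‖b‖ < τ → False := by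
  by_contra! hcon
  choose a b hab ha1 hb using fun k : ℕ => hcon (1 / ((k : ℝ) + 1)) (by positivity)
  obtain ⟨a0, ha0, φ, hφ, hlim⟩ := (isCompact_sphere (0 : P) 1).tendsto_subseq
    (x := a) (fun k => by simp [ha1 k])
  have hb0 : Tendsto (fun k => b (φ k)) atTop (𝓝 0) := by
    have : Tendsto b atTop (𝓝 0) := squeeze_zero_norm (fun k => (hb k).1.le)
      tendsto_one_div_add_atTop_nhds_zero_nat
    exact this.comp hφ.tendsto_atTop
  have h0 : a0 = 0 := by
    refine ha a0 fun w hw => ?_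
    have hc : Continuous fun z : P × X => pr2 z w := by unfold pr2; fun_prop
    exact le_of_tendsto' ((hc.tendsto _).comp (hlim.prodMk_nhds hb0)) fun k => hab (φ k) w hw
  simp [h0] at ha0

/-- A sequence of proximal normals to the solution set at points other than `zb` that become
horizontal produces a horizontal directional limiting normal to the graph. -/
theorem exists_mem_dnc3_of_isProxNormal {P X Y : Type*} [NormedAddCommGroup P]
    [InnerProductSpace ℝ P] [FiniteDimensional ℝ P] [NormedAddCommGroup X]
    [InnerProductSpace ℝ X] [FiniteDimensional ℝ X] [NormedAddCommGroup Y]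
    [InnerProductSpace ℝ Y] [FiniteDimensional ℝ Y] {M : P × X → Set Y}
    (hcl : IsClosed (gph3 M)) {zb : P × X} {κ ε : ℝ} (hκ : 0 ≤ κ)
    (hsub : ∀ z y, y ∈ M z → dist z zb < ε → ∃ z', (0 : Y) ∈ M z' ∧ dist z' z ≤ κ * ‖y‖)
    {ζ : ℕ → P × X} {a : ℕ → P} {b : ℕ → X} (hζε : ∀ k, dist (ζ k) zb < ε)
    (hζ : Tendsto ζ atTop (𝓝 zb)) (hne : ∀ k, ζ k ≠ zb)
    (hn : ∀ k, IsProxNormal {z | (0 : Y) ∈ M z} (ζ k) (a k, b k)) (ha : ∀ k, ‖a k‖ = 1)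
    (hb1 : ∀ k, ‖b k‖ ≤ 1) (hb : Tendsto b atTop (𝓝 0)) :
    ∃ (q : P) (u : X) (qs : P) (v : Y), (q, u) ≠ (0, 0) ∧ qs ≠ 0 ∧
      (q, u, (0 : Y)) ∈ tcone (gph3 M) (zb.1, zb.2, (0 : Y)) ∧
      (qs, (0 : X), v) ∈ dnc3 (gph3 M) (zb.1, zb.2, (0 : Y)) (q, u, (0 : Y)) := by
  set t : ℕ → ℝ := fun k => ‖ζ k - zb‖ with htdef
  have ht : ∀ k, 0 < t k := fun k => norm_pos_iff.2 (sub_ne_zero.2 (hne k))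
  have ht0 : Tendsto t atTop (𝓝 0) := tendsto_iff_norm_sub_tendsto_zero.1 hζ
  choose z ns hns hz hn1 hn2 hn3 using fun k => exists_mem_rnc3_of_isProxNormal hcl hκ hsub
    (hζε k) (hn k) (η := t k * (1 / ((k : ℝ) + 1))) (by have := ht k; positivity)
  have hη : Tendsto (fun k => t k * (1 / ((k : ℝ) + 1))) atTop (𝓝 0) := by
    simpa using ht0.mul (tendsto_one_div_add_atTop_nhds_zero_nat (𝕜 := ℝ))
  set d : ℕ → P × X := fun k => (t k)⁻¹ • (ζ k - zb) with hd
  have hcomp : IsCompact (sphere (0 : P × X) 1 ×ˢ sphere (0 : P) 1 ×ˢ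
      closedBall (0 : Y) (2 * (2 * κ * (1 + 1 + 1)))) :=
    (isCompact_sphere _ _).prod ((isCompact_sphere _ _).prod (isCompact_closedBall _ _))
  obtain ⟨⟨⟨q, u⟩, a0, v⟩, ⟨hqu, ha0, -⟩, φ, hφ, hlim⟩ := hcomp.tendsto_subseq
    (x := fun k => (d k, a k, (ns k).2.2)) (fun k => by
      refine ⟨?_, by simp [ha k], ?_⟩
      · rw [mem_sphere_zero_iff_norm, hd, norm_smul, norm_inv, norm_norm]
        exact inv_mul_cancel₀ (ht k).ne'
      · rw [mem_closedBall_zero_iff]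
        refine (hn3 k).trans ?_
        rw [ha k]
        gcongr
        exact hb1 k)
  have hφt := hφ.tendsto_atTop
  have hld : Tendsto (fun k => d (φ k)) atTop (𝓝 (q, u)) := (continuous_fst.tendsto _).comp hlim
  have hla : Tendsto (fun k => a (φ k)) atTop (𝓝 a0) :=
    (continuous_snd.fst.tendsto _).comp hlim
  have hlv : Tendsto (fun k => (ns (φ k)).2.2) atTop (𝓝 v) :=
    (continuous_snd.snd.tendsto _).comp hlim
  have hld3 : Tendsto (fun k => ((d (φ k)).1, (d (φ k)).2, (0 : Y))) atTop (𝓝 (q, u, 0)) :=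
    ((continuous_fst.tendsto _).comp hld).prodMk_nhds
      (((continuous_snd.tendsto _).comp hld).prodMk_nhds tendsto_const_nhds)
  have hζd : ∀ k, (zb.1, zb.2, (0 : Y)) + t k • ((d k).1, (d k).2, (0 : Y)) =
      ((ζ k).1, (ζ k).2, 0) := by
    intro k
    have : zb + t k • d k = ζ k := by rw [hd, smul_inv_smul₀ (ht k).ne', add_sub_cancel]
    rw [← this]
    simp
  refine ⟨q, u, a0, v, ?_, ?_, ⟨fun k => t (φ k), _, fun k => ht _, ht0.comp hφt, hld3, ?_⟩,
    fun k => t (φ k), fun k => (t (φ k))⁻¹ • (z (φ k) - (zb.1, zb.2, (0 : Y))),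
    fun k => ns (φ k), fun k => ht _, ht0.comp hφt, ?_, ?_, ?_⟩
  · intro h0
    rw [h0] at hqu
    simp at hqu
  · rintro rfl
    simp at ha0
  · intro k
    rw [hζd]
    exact (hn (φ k)).1
  · refine hld3.congr_dist (squeeze_zero (fun _ => dist_nonneg) (fun k => ?_)
      ((tendsto_one_div_add_atTop_nhds_zero_nat (𝕜 := ℝ)).comp hφt))
    have e : ((d (φ k)).1, (d (φ k)).2, (0 : Y)) =
        (t (φ k))⁻¹ • (((ζ (φ k)).1, (ζ (φ k)).2, (0 : Y)) - (zb.1, zb.2, (0 : Y))) := by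
      rw [← hζd, add_sub_cancel_left, inv_smul_smul₀ (ht _).ne']
    rw [e, dist_smul₀, dist_sub_right, dist_comm, norm_inv, Real.norm_of_nonneg (ht _).le,
      inv_mul_le_iff₀ (ht _)]
    exact hz (φ k)
  · have l1 : Tendsto (fun k => (ns (φ k)).1) atTop (𝓝 a0) :=
      hla.congr_dist (squeeze_zero (fun _ => dist_nonneg)
        (fun k => by rw [dist_comm]; exact hn1 (φ k)) (hη.comp hφt))
    have l2 : Tendsto (fun k => (ns (φ k)).2.1) atTop (𝓝 0) :=
      (hb.comp hφt).congr_dist (squeeze_zero (fun _ => dist_nonneg)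
        (fun k => by rw [dist_comm]; exact hn2 (φ k)) (hη.comp hφt))
    exact l1.prodMk_nhds (l2.prodMk_nhds hlv)
  · intro k
    rw [smul_inv_smul₀ (ht _).ne', add_sub_cancel]
    exact hns (φ k)

/-- Sufficient conditions for the Aubin property of the implicit multifunction `S`
(Proposition `PropAubinImplMultFunc`). -/
theorem stmt17 {l n m : ℕ} (M : Es l × Es n → Set (Es m)) (pb : Es l) (xb : Es n)
    (hcl : IsClosed (gph3 M)) (hbar : (0 : Es m) ∈ M (pb, xb))
    (ha : ∀ qs : Es l,
      (qs, (0 : Es n)) ∈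
        pol2 {qu : Es l × Es n |
          (qu.1, qu.2, (0 : Es m)) ∈ tcone (gph3 M) (pb, xb, (0 : Es m))} → qs = 0)
    (hb : ∃ κ : ℝ, 0 ≤ κ ∧ ∃ ε : ℝ, 0 < ε ∧ ∀ z : Es l × Es n, dist z (pb, xb) < ε →
      EMetric.infEdist z {z' : Es l × Es n | (0 : Es m) ∈ M z'} ≤
        ENNReal.ofReal κ * EMetric.infEdist (0 : Es m) (M z))
    (hc : ¬ ∃ (q : Es l) (u : Es n) (qs : Es l) (vs : Es m),
      (q, u) ≠ (0, 0) ∧ qs ≠ 0 ∧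
      (q, u, (0 : Es m)) ∈ tcone (gph3 M) (pb, xb, (0 : Es m)) ∧
      (qs, (0 : Es n), -vs) ∈ dnc3 (gph3 M) (pb, xb, (0 : Es m)) (q, u, (0 : Es m))) :
    AubinAround (fun p => {x | (0 : Es m) ∈ M (p, x)}) pb xb := by
  obtain ⟨κ, hκ, ε, hε, hb⟩ := hb
  have hC : IsClosed {z : Es l × Es n | (0 : Es m) ∈ M z} :=
    hcl.preimage (f := fun z : Es l × Es n => (z.1, z.2, (0 : Es m))) (by fun_prop)
  have hsub : ∀ z y, y ∈ M z → dist z (pb, xb) < ε →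
      ∃ z', (0 : Es m) ∈ M z' ∧ dist z' z ≤ κ * ‖y‖ :=
    fun z y hy hz => exists_zero_of_subregular hC hbar hκ (hb z hz) hy
  obtain ⟨τ, hτ, hpol⟩ := exists_pos_of_pol2 ha
  suffices h : ∃ r : ℝ, 0 < r ∧ ∀ z a b, dist z (pb, xb) < r →
      IsProxNormal {z : Es l × Es n | (0 : Es m) ∈ M z} z (a, b) → ‖a‖ = 1 → ‖b‖ < r → False by
    obtain ⟨r, hr, h⟩ := h
    exact aubinAround_of_isProxNormal hC hbar hr hr h
  by_contra! hcon
  set r : ℕ → ℝ := fun k => min (min ε τ) (1 / ((k : ℝ) + 1)) with hr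
  have hr1 : ∀ k, r k ≤ 1 / ((k : ℝ) + 1) := fun k => min_le_right _ _
  choose ζ a b hζ hn ha1 hb1 using fun k => hcon (r k) (by positivity)
  have hbr : ∀ k, ‖b k‖ ≤ 1 / ((k : ℝ) + 1) := fun k => (hb1 k).1.le.trans (hr1 k)
  have hlim := tendsto_one_div_add_atTop_nhds_zero_nat (𝕜 := ℝ)
  obtain ⟨q, u, qs, v, hqu, hqs, ht, hd⟩ := exists_mem_dnc3_of_isProxNormal hcl hκ hsub
    (ζ := ζ) (a := a) (b := b)
    (fun k => (hζ k).trans_le ((min_le_left _ _).trans (min_le_left _ _)))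
    (tendsto_iff_dist_tendsto_zero.2
      (squeeze_zero (fun _ => dist_nonneg) (fun k => (hζ k).le.trans (hr1 k)) hlim))
    (fun k hk => hpol (a k) (b k)
      (fun w hw => (hk ▸ hn k).pr2_nonpos (mem_tcone_zeros hε hsub hw)) (ha1 k)
      ((hb1 k).1.trans_le ((min_le_left _ _).trans (min_le_right _ _))))
    hn ha1
    (fun k => (hbr k).trans (by
      rw [div_le_one (by positivity)]
      linarith [k.cast_nonneg (α := ℝ)]))
    (squeeze_zero_norm hbr hlim)
  exact hc ⟨q, u, qs, -v, hqu, hqs, ht, by rwa [neg_neg]⟩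
end
end

section
/- Let M : ℝˡ × ℝⁿ ⇒ ℝᵐ have closed graph, 0 ∈ M(p̄,x̄), and S(p) := {x : 0 ∈ M(p,x)}. If S has the Aubin property around (p̄, x̄), then {u : 0 ∈ DM(p̄,x̄,0)(q,u)} ≠ ∅ for every q ∈ ℝˡ. -/
open Filter Topology Metric Set
open scoped RealInnerProductSpace

noncomputable section

/-- Necessity, for the Aubin property of the implicit multifunction `S`, of the
solvability of the linearized inclusion `0 ∈ DM(pb,xb,0)(q,u)` for every `q`. -/
theorem stmt19 {l n m : ℕ} (M : Es l × Es n → Set (Es m)) (pb : Es l) (xb : Es n)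
    (hcl : IsClosed (gph3 M)) (hbar : (0 : Es m) ∈ M (pb, xb))
    (haub : AubinAround (fun p => {x | (0 : Es m) ∈ M (p, x)}) pb xb) :
    ∀ q : Es l, ∃ u : Es n,
      (q, u, (0 : Es m)) ∈ tcone (gph3 M) (pb, xb, (0 : Es m)) := by
  intro q
  obtain ⟨κ, hκ, ε, hε, H⟩ := haub
  set C : ℝ := κ * ‖q‖ + 1 with hC
  have hden : 0 < ‖q‖ + 1 := by positivity
  set t : ℕ → ℝ := fun k => ε / (‖q‖ + 1) * (1 / ((k : ℝ) + 1)) with ht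
  have htpos : ∀ k, 0 < t k := fun k => by positivity
  have htlim : Tendsto t atTop (𝓝 0) := by
    simpa [ht] using (tendsto_one_div_add_atTop_nhds_zero_nat (𝕜 := ℝ)).const_mul (ε / (‖q‖ + 1))
  have htq : ∀ k, t k * ‖q‖ < ε := fun k => by
    have h1 : 1 / ((k : ℝ) + 1) ≤ 1 := by
      rw [div_le_one (by positivity)]
      linarith [Nat.cast_nonneg (α := ℝ) k]
    have h2 : t k ≤ ε / (‖q‖ + 1) := mul_le_of_le_one_right (by positivity) h1
    have h3 : t k * (‖q‖ + 1) ≤ ε := (le_div_iff₀ hden).1 h2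
    linarith [htpos k]
  have hx : ∀ k, ∃ x : Es n, (0 : Es m) ∈ M (pb + t k • q, x) ∧ dist xb x < C * t k := by
    intro k
    have hd : dist pb (pb + t k • q) = t k * ‖q‖ := by
      rw [dist_self_add_right, norm_smul, Real.norm_of_nonneg (htpos k).le]
    have h1 := H (pb + t k • q) pb xb (by rw [dist_comm, hd]; exact htq k)
      (by rwa [dist_self]) hbar
    have h2 : ENNReal.ofReal (κ * dist pb (pb + t k • q)) < ENNReal.ofReal (C * t k) := by
      rw [hd, ENNReal.ofReal_lt_ofReal_iff (mul_pos (by positivity) (htpos k)), hC]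
      linarith [htpos k]
    obtain ⟨x, hxM, hxd⟩ := Metric.infEDist_lt_iff.1 (h1.trans_lt h2)
    rw [edist_dist, ENNReal.ofReal_lt_ofReal_iff (mul_pos (by positivity) (htpos k))] at hxd
    exact ⟨x, hxM, hxd⟩
  choose x hxM hxd using hx
  have hball : ∀ k, (t k)⁻¹ • (x k - xb) ∈ closedBall (0 : Es n) C := by
    intro k
    rw [mem_closedBall_zero_iff, norm_smul, norm_inv, Real.norm_of_nonneg (htpos k).le,
      inv_mul_le_iff₀ (htpos k), ← dist_eq_norm, dist_comm, mul_comm]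
    exact (hxd k).le
  obtain ⟨u, -, φ, hφ, hu⟩ := (isCompact_closedBall (0 : Es n) C).tendsto_subseq hball
  refine ⟨u, t ∘ φ, fun k => (q, (t (φ k))⁻¹ • (x (φ k) - xb), 0), fun k => htpos _,
    htlim.comp hφ.tendsto_atTop, tendsto_const_nhds.prodMk_nhds (hu.prodMk_nhds tendsto_const_nhds),
    fun k => ?_⟩
  simpa [gph3, smul_smul, mul_inv_cancel₀ (htpos (φ k)).ne'] using hxM (φ k)
end
end
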